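/- Every injective endomorphism of the semigroup B is of the form ϖ^n ∘ ε₁ for some n ∈ ℕ and some injective monoid endomorphism ε₁ of B. -/

import Mathlib

/-- The underlying set of the semigroup `B_ω^{F²}`: `ℕ × ℕ × {0,1}`. -/
abbrev B : Type := ℕ × ℕ × Fin 2

/-- Truncated subtraction of a natural number from an element of `{0,1}`. -/
def fsub (p : Fin 2) (n : ℕ) : Fin 2 :=
  ⟨p.val - n, lt_of_le_of_lt (Nat.sub_le _ _) p.isLt⟩

/-- The multiplication on `B = ℕ × ℕ × {0,1}` realizing the semigroup `B_ω^{F²}`.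
In the first case `i₁ − j₁ + i₂` is computed as `i₁ + (i₂ − j₁)` (exact, since
`j₁ < i₂`), and in the third case `j₁ − i₂ + j₂` as `(j₁ − i₂) + j₂` (exact, since
`j₁ > i₂`). -/
def bmul (x y : B) : B :=
  if x.2.1 < y.1 then
    (x.1 + (y.1 - x.2.1), y.2.1, max (fsub x.2.2 (y.1 - x.2.1)) y.2.2)
  else if x.2.1 = y.1 then
    (x.1, y.2.1, max x.2.2 y.2.2)
  else
    (x.1, x.2.1 - y.1 + y.2.1, max x.2.2 (fsub y.2.2 (x.2.1 - y.1)))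

/-- The map `ϖ : B → B`, `ϖ(i,j,0) = (i,j,1)`, `ϖ(i,j,1) = (i+1,j+1,0)`. -/
def varpi (x : B) : B :=
  if x.2.2 = 0 then (x.1, x.2.1, 1) else (x.1 + 1, x.2.1 + 1, 0)

theorem fsub_of_pos (p : Fin 2) {n : ℕ} (hn : 0 < n) : fsub p n = 0 := by
  apply Fin.ext
  simp only [fsub, Fin.val_zero]
  omega

/-- The multiplication of `B` without truncated subtraction on `Fin 2`. -/
theorem bmul_mk (i j k l : ℕ) (p q : Fin 2) :
    bmul (i, j, p) (k, l, q) =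
      if j < k then (i + (k - j), l, q) else if j = k then (i, l, max p q)
      else (i, j - k + l, p) := by
  simp only [bmul]
  split_ifs with h₁ h₂
  · rw [fsub_of_pos p (by omega), max_eq_right (Fin.zero_le q)]
  · rfl
  · rw [fsub_of_pos q (by omega), max_eq_left (Fin.zero_le p)]

theorem varpi_mk_zero (i j : ℕ) : varpi (i, j, 0) = (i, j, 1) := rfl

theorem varpi_mk_one (i j : ℕ) : varpi (i, j, 1) = (i + 1, j + 1, 0) := rfl

theorem fin_two_induction {P : Fin 2 → Prop} (p : Fin 2) (h₀ : P 0) (h₁ : P 1) : P p :=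
  Fin.forall_fin_two.2 ⟨h₀, h₁⟩ p

theorem varpi_bmul (x y : B) : varpi (bmul x y) = bmul (varpi x) (varpi y) := by
  obtain ⟨i, j, p⟩ := x
  obtain ⟨k, l, q⟩ := y
  have h₀₁ : max (0 : Fin 2) 1 = 1 := rfl
  have h₁₀ : max (1 : Fin 2) 0 = 1 := rfl
  induction p using fin_two_induction <;> induction q using fin_two_induction <;>
    simp only [bmul_mk, varpi_mk_zero, varpi_mk_one, h₀₁, h₁₀, max_self] <;>
    split_ifs <;> first
      | omega
      | (simp only [varpi_mk_zero, varpi_mk_one, Prod.mk.injEq, and_true, true_and] <;> omega)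

theorem varpi_injective : Function.Injective varpi := by
  rintro ⟨i, j, p⟩ ⟨k, l, q⟩ h
  induction p using fin_two_induction <;> induction q using fin_two_induction <;>
    simp_all [varpi_mk_zero, varpi_mk_one]

theorem varpi_iterate_bmul (n : ℕ) (x y : B) :
    varpi^[n] (bmul x y) = bmul (varpi^[n] x) (varpi^[n] y) := by
  induction n generalizing x y with
  | zero => rfl
  | succ n ih => simp only [Function.iterate_succ_apply, varpi_bmul, ih]

theorem varpi_iterate_two_mul (n i j : ℕ) (p : Fin 2) :
    varpi^[2 * n] (i, j, p) = (i + n, j + n, p) := by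
  induction n generalizing i j with
  | zero => rfl
  | succ n ih =>
    rw [Nat.mul_succ, Function.iterate_add_apply]
    have h : varpi^[2] (i, j, p) = (i + 1, j + 1, p) := by
      induction p using fin_two_induction <;> rfl
    rw [h, ih]
    simp only [Prod.mk.injEq, and_true]
    omega

/-- Every idempotent of `B` is an iterated image of the identity under `varpi`. -/
theorem exists_varpi_iterate_of_idempotent {e : B} (he : bmul e e = e) :
    ∃ n : ℕ, varpi^[n] (0, 0, 0) = e := by
  obtain ⟨i, j, p⟩ := e
  have hij : i = j := by
    rw [bmul_mk] at he
    split_ifs at he <;> simp only [Prod.mk.injEq] at he <;> omega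
  subst hij
  induction p using fin_two_induction with
  | h₀ => exact ⟨2 * i, by simp [varpi_iterate_two_mul]⟩
  | h₁ =>
    exact ⟨2 * i + 1, by
      simp [Function.iterate_succ_apply, varpi_mk_zero, varpi_iterate_two_mul]⟩

/-- The local submonoid of `B` at the idempotent `varpi^[n] (0, 0, 0)` lies in the range of
`varpi^[n]`. -/
theorem exists_varpi_iterate_eq {n : ℕ} {x : B} (hl : bmul (varpi^[n] (0, 0, 0)) x = x)
    (hr : bmul x (varpi^[n] (0, 0, 0)) = x) : ∃ y : B, varpi^[n] y = x := by
  obtain ⟨a, b, q⟩ := x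
  obtain ⟨i, rfl | rfl⟩ := Nat.even_or_odd' n
  · simp only [varpi_iterate_two_mul, bmul_mk] at hl hr ⊢
    refine ⟨(a - i, b - i, q), ?_⟩
    rw [varpi_iterate_two_mul]
    split_ifs at hl hr <;> simp only [Prod.mk.injEq, and_true] at hl hr ⊢ <;> omega
  · simp only [Function.iterate_succ_apply, varpi_mk_zero, varpi_iterate_two_mul, bmul_mk]
      at hl hr ⊢
    induction q using fin_two_induction with
    | h₀ =>
      refine ⟨(a - i - 1, b - i - 1, 1), ?_⟩
      rw [varpi_mk_one, varpi_iterate_two_mul]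
      split_ifs at hl hr <;> grind
    | h₁ =>
      refine ⟨(a - i, b - i, 0), ?_⟩
      rw [varpi_mk_zero, varpi_iterate_two_mul]
      split_ifs at hl hr <;> simp only [Prod.mk.injEq, and_true] at hl hr ⊢ <;> omega

theorem one_bmul (x : B) : bmul (0, 0, 0) x = x := by
  obtain ⟨a, b, q⟩ := x
  rw [bmul_mk]
  split_ifs with h₁ h₂
  · simp
  · rw [h₂, max_eq_right (Fin.zero_le q)]
  · omega

theorem bmul_one (x : B) : bmul x (0, 0, 0) = x := by
  obtain ⟨a, b, q⟩ := x
  rw [bmul_mk]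
  split_ifs with h₁ h₂
  · omega
  · rw [h₂, max_eq_left (Fin.zero_le q)]
  · simp


/-- Every injective endomorphism of `B` is of the form `ϖ^n ∘ ε₁` for some `n ∈ ℕ`
and some injective monoid endomorphism `ε₁` of `B`. -/
theorem injective_endomorphism_decomposition (ε : B → B)
    (hε : ∀ x y : B, ε (bmul x y) = bmul (ε x) (ε y))
    (hinj : Function.Injective ε) :
    ∃ (n : ℕ) (ε₁ : B → B),
      (∀ x y : B, ε₁ (bmul x y) = bmul (ε₁ x) (ε₁ y)) ∧
      ε₁ ((0, 0, 0) : B) = ((0, 0, 0) : B) ∧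
      Function.Injective ε₁ ∧
      ε = varpi^[n] ∘ ε₁ := by
  obtain ⟨n, hn⟩ := exists_varpi_iterate_of_idempotent (e := ε (0, 0, 0))
    (by rw [← hε, one_bmul])
  have hrange : ∀ x, ∃ y, varpi^[n] y = ε x := fun x =>
    exists_varpi_iterate_eq (by rw [hn, ← hε, one_bmul]) (by rw [hn, ← hε, bmul_one])
  choose ε₁ hε₁ using hrange
  have hϖ : Function.Injective varpi^[n] := varpi_injective.iterate n
  refine ⟨n, ε₁, fun x y => hϖ ?_, hϖ ?_, fun x y hxy => hinj ?_, funext fun x => (hε₁ x).symm⟩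
  · rw [varpi_iterate_bmul, hε₁, hε₁, hε₁, hε]
  · rw [hε₁, hn]
  · rw [← hε₁ x, ← hε₁ y, hxy]
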